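/- Let A be a unital C*-algebra, J = [[0,1],[-1,0]] ∈ M₂(A), and let U(θ_H) = { g ∈ GL₂(A) : J g* J⁻¹ = g⁻¹ }. If a ∈ U(θ_H) with polar decomposition a = u|a| (u unitary, |a| = (a*a)^{1/2}), then both u and |a| belong to U(θ_H). -/

import Mathlib

set_option maxHeartbeats 1000000

theorem aux_sqrt_unique {B : Type*} [CStarAlgebra B] (p q s t : B)
    (hp : p = star s * s) (hq : q = star t * t) (h : p * p = q * q) : p = q := by
  let _ := CStarAlgebra.spectralOrder B
  have := CStarAlgebra.spectralOrderedRing B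
  have hp0 : 0 ≤ p := hp ▸ star_mul_self_nonneg s
  have hq0 : 0 ≤ q := hq ▸ star_mul_self_nonneg t
  rw [← CFC.sqrt_unique h hp0]
  exact CFC.sqrt_unique rfl hq0

theorem aux_matrix {A : Type*} [CStarAlgebra A] (p q s t : Matrix (Fin 2) (Fin 2) A)
    (hp : p = star s * s) (hq : q = star t * t) (h : p * p = q * q) : p = q := by
  let _ := CStarAlgebra.spectralOrder A
  have := CStarAlgebra.spectralOrderedRing A
  let e : Matrix (Fin 2) (Fin 2) A ≃⋆ₐ[ℂ] CStarMatrix (Fin 2) (Fin 2) A :=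
    CStarMatrix.ofMatrixStarAlgEquiv
  apply e.injective
  refine aux_sqrt_unique (e p) (e q) (e s) (e t) ?_ ?_ ?_
  · rw [← map_star, ← map_mul, ← hp]
  · rw [← map_star, ← map_mul, ← hq]
  · rw [← map_mul, ← map_mul, h]

theorem aux_ring {R : Type*} [Ring R] [StarRing R]
    (uniq : ∀ p q s t : R, p = star s * s → q = star t * t → p * p = q * q → p = q)
    (J : R) (hJs : star J = -J) (hJJ : J * J = -1)
    (a u p : R)
    (ha : IsUnit a)
    (haθ : J * star a * Ring.inverse J = Ring.inverse a)
    (hu : u ∈ unitary R)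
    (hpos : ∃ s : R, p = star s * s)
    (hp : IsUnit p)
    (hsq : p * p = star a * a)
    (hpolar : a = u * p) :
    (J * star u * Ring.inverse J = Ring.inverse u) ∧
    (J * star p * Ring.inverse J = Ring.inverse p) := by
  obtain ⟨s, hs⟩ := hpos
  have hps : star p = p := by rw [hs]; simp
  have hinv : ∀ x y : R, x * y = 1 → y * x = 1 → Ring.inverse x = y := fun x y h1 h2 =>
    Ring.inverse_unit (⟨x, y, h1, h2⟩ : Rˣ)
  have hJi : Ring.inverse J = -J := hinv _ _ (by simp [hJJ]) (by simp [hJJ])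
  have hui : Ring.inverse u = star u := hinv _ _ hu.2 hu.1
  obtain ⟨P, rfl⟩ := hp
  rw [Ring.inverse_unit, hui, hps, hJi]
  rw [hJi] at haθ
  have h1 : a * (J * star a * -J) = 1 := by rw [haθ]; exact Ring.mul_inverse_cancel a ha
  have h2 : (J * star a * -J) * a = 1 := by rw [haθ]; exact Ring.inverse_mul_cancel a ha
  have hPs : star (↑P⁻¹ : R) = ↑P⁻¹ := by
    have : star (↑P⁻¹ : R) * P = 1 := by
      rw [← hps, ← star_mul]; simp
    exact (Units.inv_eq_of_mul_eq_one_left this).symm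
  have hPsq : (J * ↑P⁻¹ * -J) * (J * ↑P⁻¹ * -J) = (P : R) * P := by
    have e : (J * ↑P⁻¹ * -J) * (J * ↑P⁻¹ * -J) = J * ↑(P * P)⁻¹ * -J := by
      calc _ = -(J * ↑P⁻¹ * (J * J) * ↑P⁻¹ * -J) := by noncomm_ring
        _ = _ := by rw [hJJ]; simp [mul_assoc]
    have h3 : (↑(P * P)⁻¹ : R) = J * star a * a * -J := by
      refine (Units.inv_eq_of_mul_eq_one_left ?_)
      have h4 : J * a * -J * star a = 1 := by
        have := congrArg star h1
        simpa [hJs, mul_assoc] using this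
      rw [Units.val_mul, hsq]
      calc J * star a * a * -J * (star a * a)
          = J * star a * (- (J * J)) * a * -J * (star a * a) := by rw [hJJ]; simp
        _ = (J * star a * -J) * (J * a * -J * star a) * a := by noncomm_ring
        _ = 1 := by rw [h4, mul_one, h2]
    rw [e, h3, hsq]
    calc J * (J * star a * a * -J) * -J = (J * J) * star a * a * (J * J) := by noncomm_ring
      _ = _ := by rw [hJJ]; simp
  have key : (P : R) = J * ↑P⁻¹ * -J := by
    refine uniq _ _ s (s * ↑P⁻¹ * -J) hs ?_ hPsq.symm
    simp only [star_mul, star_neg, hJs, hPs, neg_neg]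
    calc J * ↑P⁻¹ * -J = J * ↑P⁻¹ * (P * ↑P⁻¹) * -J := by simp
      _ = _ := by rw [hs]; simp only [mul_assoc]
  have hpR : J * ↑P * -J = (↑P⁻¹ : R) := by
    conv_lhs => rw [key]
    calc J * (J * ↑P⁻¹ * -J) * -J = (J * J) * ↑P⁻¹ * (J * J) := by noncomm_ring
      _ = _ := by rw [hJJ]; simp
  refine ⟨?_, hpR⟩
  -- inverse of `a`: `J p u* J⁻¹ = p⁻¹ (J u* J⁻¹)` equals `p⁻¹ u*`
  have h5 : Ring.inverse a = ↑P⁻¹ * star u := by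
    refine hinv _ _ ?_ ?_
    · rw [hpolar, mul_assoc, Units.mul_inv_cancel_left, hu.2]
    · rw [hpolar, mul_assoc, ← mul_assoc (star u), hu.1]; simp
  have h6 : (↑P⁻¹ : R) * (J * star u * -J) = ↑P⁻¹ * star u := by
    rw [← h5, ← haθ, hpolar, star_mul, hps, ← hpR]
    calc J * ↑P * -J * (J * star u * -J) = J * ↑P * (-(J * J)) * star u * -J := by noncomm_ring
      _ = _ := by rw [hJJ]; simp [mul_assoc]
  exact (Units.mul_right_inj P⁻¹).1 h6



/-- If `a ∈ U(θ_H) = { g ∈ GL₂(A) : J g* J⁻¹ = g⁻¹ }` has polar decomposition `a = u |a|`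
(`u` unitary, `|a|` the positive invertible square root of `a* a`), then both `u` and `|a|`
belong to `U(θ_H)`. -/
theorem polar_parts_mem_unitaryGroupOfFormH {A : Type*} [CStarAlgebra A]
    (J : Matrix (Fin 2) (Fin 2) A) (hJ : J = !![0, 1; -1, 0])
    (a u p : Matrix (Fin 2) (Fin 2) A)
    (ha : IsUnit a)
    (haθ : J * star a * Ring.inverse J = Ring.inverse a)
    (hu : u ∈ unitary (Matrix (Fin 2) (Fin 2) A))
    (hpos : ∃ s : Matrix (Fin 2) (Fin 2) A, p = star s * s)
    (hp : IsUnit p)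
    (hsq : p * p = star a * a)
    (hpolar : a = u * p) :
    (J * star u * Ring.inverse J = Ring.inverse u) ∧
    (J * star p * Ring.inverse J = Ring.inverse p) := by
  refine aux_ring aux_matrix J ?_ ?_ a u p ha haθ hu hpos hp hsq hpolar
  · subst hJ
    ext i j
    fin_cases i <;> fin_cases j <;> simp [Matrix.star_apply]
  · subst hJ
    ext i j
    fin_cases i <;> fin_cases j <;> simp [Matrix.mul_apply]
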